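/- arXiv:2209.07207 — 2 statements merged into one kernel-verified Lean document; each statement's English description precedes it below -/
import Mathlib

section
/- Let w ∈ L^∞(ℝ³, ℝ), M ≥ 0, and f, g ∈ L²(ℝ³, ℂ) with ‖f‖_{L²} ≤ M and ‖g‖_{L²} ≤ M. Then ‖(w*|f|²) f − (w*|g|²) g‖_{L²} ≤ 3 ‖w‖_{L^∞} M² ‖f − g‖_{L²}. -/
open MeasureTheory Real Filter Topology
open scoped ENNReal

noncomputable section

lemma cs_aux (h k : EuclideanSpace ℝ (Fin 3) → ℂ) (hh : MemLp h 2) (hk : MemLp k 2) :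
    Integrable (fun y => ‖h y‖ * ‖k y‖) ∧
    ∫ y, ‖h y‖ * ‖k y‖ ≤ (eLpNorm h 2 volume).toReal * (eLpNorm k 2 volume).toReal := by
  have hi : MemLp (fun y => ‖h y‖ * ‖k y‖) 1 := hk.norm.mul hh.norm
  refine ⟨memLp_one_iff_integrable.1 hi, ?_⟩
  have h1 : eLpNorm ((fun y => ‖h y‖) • (fun y => ‖k y‖)) 1 volume ≤
      eLpNorm (fun y => ‖h y‖) 2 volume * eLpNorm (fun y => ‖k y‖) 2 volume :=
    eLpNorm_smul_le_mul_eLpNorm hk.norm.1 hh.norm.1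
  rw [eLpNorm_norm, eLpNorm_norm] at h1
  have h2 := ENNReal.toReal_mono (ENNReal.mul_ne_top hh.eLpNorm_ne_top hk.eLpNorm_ne_top) h1
  rw [ENNReal.toReal_mul] at h2
  refine le_trans (le_of_eq ?_) h2
  rw [eLpNorm_one_eq_lintegral_enorm, ← integral_norm_eq_lintegral_enorm
    (f := (fun y => ‖h y‖) • (fun y => ‖k y‖)) hi.1]
  congr 1
  ext y
  simp

lemma w_aux (w : EuclideanSpace ℝ (Fin 3) → ℝ) (hw : MemLp w ⊤) (x : EuclideanSpace ℝ (Fin 3)) :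
    AEStronglyMeasurable (fun y => w (x - y)) volume ∧
    ∀ᵐ y, ‖w (x - y)‖ ≤ (eLpNorm w ⊤ volume).toReal := by
  have q := quasiMeasurePreserving_sub_left (volume : Measure (EuclideanSpace ℝ (Fin 3))) x
  refine ⟨hw.1.comp_quasiMeasurePreserving q, q.ae (p := fun z => ‖w z‖ ≤ (eLpNorm w ⊤ volume).toReal) ?_⟩
  filter_upwards [ae_le_eLpNormEssSup (f := w) (μ := volume)] with y hy
  rw [← eLpNorm_exponent_top] at hy
  have := ENNReal.toReal_mono hw.eLpNorm_ne_top hy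
  simpa using this

lemma conv_aux (w : EuclideanSpace ℝ (Fin 3) → ℝ) (hw : MemLp w ⊤)
    (x : EuclideanSpace ℝ (Fin 3)) (u : EuclideanSpace ℝ (Fin 3) → ℝ) (hu : Integrable u) :
    Integrable (fun y => w (x - y) * u y) ∧
    ‖∫ y, w (x - y) * u y‖ ≤ (eLpNorm w ⊤ volume).toReal * ∫ y, ‖u y‖ := by
  obtain ⟨h1, h2⟩ := w_aux w hw x
  refine ⟨hu.bdd_mul h1 h2, ?_⟩
  rw [← integral_const_mul]
  refine norm_integral_le_of_norm_le (hu.norm.const_mul _) ?_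
  filter_upwards [h2] with y hy
  rw [norm_mul]
  gcongr

/-- Lipschitz estimate for the Hartree non-linearity on an `L²`-ball of radius `M`:
`‖(w*|f|²)f - (w*|g|²)g‖_{L²} ≤ 3 ‖w‖_{L^∞} M² ‖f - g‖_{L²}`. -/
theorem hartree_lipschitz (w : EuclideanSpace ℝ (Fin 3) → ℝ) (M : ℝ) (hM : 0 ≤ M)
    (f g : EuclideanSpace ℝ (Fin 3) → ℂ)
    (hw : MemLp w ⊤) (hf : MemLp f 2) (hg : MemLp g 2)
    (hfM : (eLpNorm f 2 volume).toReal ≤ M) (hgM : (eLpNorm g 2 volume).toReal ≤ M) :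
    eLpNorm (fun x => (∫ y, w (x - y) * ‖f y‖ ^ 2 : ℝ) • f x
        - (∫ y, w (x - y) * ‖g y‖ ^ 2 : ℝ) • g x) 2 volume
      ≤ ENNReal.ofReal (3 * (eLpNorm w ⊤ volume).toReal * M ^ 2)
          * eLpNorm (fun x => f x - g x) 2 volume := by
  have hd : MemLp (fun x => f x - g x) 2 := hf.sub hg
  set W := (eLpNorm w ⊤ volume).toReal with hW
  set N := (eLpNorm (fun x => f x - g x) 2 volume).toReal with hN
  have hW0 : 0 ≤ W := ENNReal.toReal_nonneg
  have hN0 : 0 ≤ N := ENNReal.toReal_nonneg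
  obtain ⟨iff', cff⟩ := cs_aux f f hf hf
  obtain ⟨igg, cgg⟩ := cs_aux g g hg hg
  obtain ⟨idf, cdf⟩ := cs_aux _ f hd hf
  obtain ⟨idg, cdg⟩ := cs_aux _ g hd hg
  simp only [← pow_two] at iff' cff igg
  have b1 : ∀ x, ‖∫ y, w (x - y) * ‖f y‖ ^ 2‖ ≤ W * M ^ 2 := by
    intro x
    refine (conv_aux w hw x _ iff').2.trans ?_
    gcongr
    simp only [norm_pow, norm_norm]
    exact cff.trans (by gcongr)
  have b2 : ∀ x, ‖(∫ y, w (x - y) * ‖f y‖ ^ 2) - ∫ y, w (x - y) * ‖g y‖ ^ 2‖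
      ≤ W * (2 * M * N) := by
    intro x
    rw [← integral_sub (conv_aux w hw x _ iff').1 (conv_aux w hw x _ igg).1]
    simp only [← mul_sub]
    refine (conv_aux w hw x _ (iff'.sub igg)).2.trans ?_
    gcongr
    calc ∫ y, ‖((fun y => ‖f y‖ ^ 2) - fun y => ‖g y‖ ^ 2) y‖
        ≤ ∫ y, (‖f y - g y‖ * ‖f y‖ + ‖f y - g y‖ * ‖g y‖) := by
          refine integral_mono (iff'.sub igg).norm (idf.add idg) fun y => ?_
          have : ‖f y‖ ^ 2 - ‖g y‖ ^ 2 = (‖f y‖ - ‖g y‖) * (‖f y‖ + ‖g y‖) := by ring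
          simp only [Pi.sub_apply, this, norm_mul, ← mul_add]
          rw [Real.norm_eq_abs (‖f y‖ + ‖g y‖), abs_of_nonneg (by positivity)]
          gcongr
          exact abs_norm_sub_norm_le _ _
      _ ≤ N * M + N * M := by
          rw [integral_add idf idg]
          exact add_le_add (cdf.trans (by gcongr)) (cdg.trans (by gcongr))
      _ = 2 * M * N := by ring
  have key : ∀ x, ‖(∫ y, w (x - y) * ‖f y‖ ^ 2 : ℝ) • f x
        - (∫ y, w (x - y) * ‖g y‖ ^ 2 : ℝ) • g x‖ ≤
      ((fun x => (W * M ^ 2) * ‖f x - g x‖) + (fun x => (W * (2 * M * N)) * ‖g x‖)) x := by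
    intro x
    have e : (∫ y, w (x - y) * ‖f y‖ ^ 2 : ℝ) • f x - (∫ y, w (x - y) * ‖g y‖ ^ 2 : ℝ) • g x
      = (∫ y, w (x - y) * ‖f y‖ ^ 2 : ℝ) • (f x - g x) +
        ((∫ y, w (x - y) * ‖f y‖ ^ 2) - ∫ y, w (x - y) * ‖g y‖ ^ 2) • g x := by
      rw [smul_sub, sub_smul]; abel
    rw [e]
    refine (norm_add_le _ _).trans ?_
    rw [norm_smul, norm_smul]
    exact add_le_add (mul_le_mul_of_nonneg_right (b1 x) (norm_nonneg _))
      (mul_le_mul_of_nonneg_right (b2 x) (norm_nonneg _))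
  have hc : ∀ (c : ℝ) (h : EuclideanSpace ℝ (Fin 3) → ℂ), 0 ≤ c →
      eLpNorm (fun x => c * ‖h x‖) 2 volume = ENNReal.ofReal c * eLpNorm h 2 volume := by
    intro c h hc
    have := eLpNorm_const_smul c (fun x => ‖h x‖) 2 (volume : Measure (EuclideanSpace ℝ (Fin 3)))
    rw [eLpNorm_norm, Real.enorm_of_nonneg hc] at this
    exact this
  refine (eLpNorm_mono_real key).trans ?_
  refine (eLpNorm_add_le (hd.norm.const_mul _).1 (hg.norm.const_mul _).1 (by norm_num)).trans ?_
  rw [hc _ (fun x => f x - g x) (by positivity), hc _ g (by positivity),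
    ← ENNReal.ofReal_toReal hd.eLpNorm_ne_top, ← ENNReal.ofReal_toReal hg.eLpNorm_ne_top, ← hN,
    ← ENNReal.ofReal_mul (by positivity), ← ENNReal.ofReal_mul (by positivity),
    ← ENNReal.ofReal_mul (by positivity), ← ENNReal.ofReal_add (by positivity) (by positivity)]
  apply ENNReal.ofReal_le_ofReal
  calc W * M ^ 2 * N + W * (2 * M * N) * (eLpNorm g 2 volume).toReal
      ≤ W * M ^ 2 * N + W * (2 * M * N) * M := by gcongr
    _ = 3 * W * M ^ 2 * N := by ring
end
end

section
/- Let V : ℝ³ → ℝ be measurable with V(x) > 0 for almost every x and R(V) < ∞, and let g ∈ L²(ℝ³, ℂ). If for almost every x ∈ ℝ³ one has ∫_{ℝ³} √(V(x)) e^{−|x−y|/√2} √(V(y)) g(y) / (8π |x−y|) dy = 0, then g = 0 almost everywhere. Equivalently, the Birman–Schwinger operator B := √V (2(−Δ)+1)^{−1} √V on L²(ℝ³) does not have zero as an eigenvalue when V > 0 almost everywhere. -/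
open MeasureTheory Real Filter Topology
open scoped ENNReal

noncomputable section

/-- The Rollnik functional of a potential `V` on `ℝ³`. -/
def rollnik (V : EuclideanSpace ℝ (Fin 3) → ℝ) : ℝ≥0∞ :=
  ∫⁻ x, ∫⁻ y, ENNReal.ofReal (|V x| * |V y| / ‖x - y‖ ^ 2)

abbrev E3 := EuclideanSpace ℝ (Fin 3)
def HK (t : ℝ) (z : E3) : ℝ := exp (-‖z‖^2/(8*t)) / (√(8*π*t))^3
def GK (z : E3) : ℝ := exp (-‖z‖ / √2) / (8*π*‖z‖)

lemma HK_nonneg (t z) : 0 ≤ HK t z := by unfold HK; positivity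

lemma HK_meas (z : E3) : Measurable (fun t => HK t z) := by unfold HK; fun_prop

lemma gauss3 (β : ℝ) (hβ : 0 < β) (m : E3) :
    ∫ x : E3, exp (-β * ‖x - m‖^2) = (√(π/β))^3 := by
  rw [integral_sub_right_eq_self (fun x : E3 => exp (-β * ‖x‖^2)) m,
    GaussianFourier.integral_rexp_neg_mul_sq_norm hβ]
  simp only [finrank_euclideanSpace, Fintype.card_fin]
  rw [Real.sqrt_eq_rpow, ← Real.rpow_natCast, ← Real.rpow_mul (by positivity)]
  norm_num

lemma gauss3_int (β : ℝ) (hβ : 0 < β) (m : E3) :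
    Integrable (fun x : E3 => exp (-β * ‖x - m‖^2)) := by
  by_contra h
  have := integral_undef h
  rw [gauss3 β hβ m] at this
  have : 0 < (√(π/β))^3 := by positivity
  linarith

lemma HK_mul {s t : ℝ} (hs : 0 < s) (ht : 0 < t) (c y x : E3) :
    HK s (x - c) * HK t (x - y) = (HK (s+t) (y - c) / (√(π/((s+t)/(8*s*t))))^3) *
      exp (-((s+t)/(8*s*t)) * ‖x - ((t/(s+t)) • c + (s/(s+t)) • y)‖^2) := by
  have hst : 0 < s + t := by positivity
  have e1 : -‖x - c‖^2/(8*s) + -‖x-y‖^2/(8*t) = -‖y-c‖^2/(8*(s+t)) +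
      -((s+t)/(8*s*t)) * ‖x - ((t/(s+t)) • c + (s/(s+t)) • y)‖^2 := by
    simp only [EuclideanSpace.norm_sq_eq, Fin.sum_univ_three, Real.norm_eq_abs, sq_abs,
      PiLp.sub_apply, PiLp.add_apply, PiLp.smul_apply, smul_eq_mul]
    field_simp
    ring
  have e2 : √(8*π*s) * √(8*π*t) = √(8*π*(s+t)) * √(π/((s+t)/(8*s*t))) := by
    rw [← Real.sqrt_mul (by positivity), ← Real.sqrt_mul (by positivity)]
    congr 1
    field_simp
  unfold HK
  rw [div_mul_div_comm, ← Real.exp_add, e1, Real.exp_add, ← mul_pow, e2, mul_pow]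
  field_simp

lemma HK_mul_int {s t : ℝ} (hs : 0 < s) (ht : 0 < t) (c y : E3) :
    Integrable (fun x => HK s (x - c) * HK t (x - y)) := by
  simp_rw [HK_mul hs ht c y]
  exact (gauss3_int _ (by positivity) _).const_mul _

lemma HK_semigroup {s t : ℝ} (hs : 0 < s) (ht : 0 < t) (c y : E3) :
    ∫ x, HK s (x - c) * HK t (x - y) = HK (s+t) (y-c) := by
  simp_rw [HK_mul hs ht c y]
  have hst : 0 < s + t := by positivity
  rw [integral_const_mul, gauss3 _ (by positivity)]
  have : 0 < √(π/((s+t)/(8*s*t))) := by positivity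
  field_simp

lemma HK_semigroup_l {s t : ℝ} (hs : 0 < s) (ht : 0 < t) (c y : E3) :
    ∫⁻ x, ENNReal.ofReal (HK s (x - c) * HK t (x - y)) = ENNReal.ofReal (HK (s+t) (y-c)) := by
  rw [← HK_semigroup hs ht, ofReal_integral_eq_lintegral_ofReal (HK_mul_int hs ht c y)]
  exact ae_of_all _ fun x => mul_nonneg (HK_nonneg _ _) (HK_nonneg _ _)

lemma HK_bound {s : ℝ} (hs : 0 < s) (c : E3) : ∃ C : ℝ, 0 ≤ C ∧ ∀ t, s ≤ t → ∀ y : E3,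
    HK t (y - c) ≤ C * (1 + ‖y‖)⁻¹ := by
  set w0 := √(8*π*s) with hw0
  have hw0p : 0 < w0 := by positivity
  refine ⟨(1+‖c‖)/w0^3 + 1/w0^2, by positivity, fun t hst y => ?_⟩
  have ht : 0 < t := hs.trans_le hst
  rw [← div_eq_mul_inv, le_div_iff₀ (by positivity)]
  unfold HK
  set w := √(8*π*t) with hw
  have hwp : 0 < w := by positivity
  have hww : w0 ≤ w := Real.sqrt_le_sqrt (by gcongr)
  set r := ‖y - c‖ with hr
  have hy : ‖y‖ ≤ r + ‖c‖ := by
    have := norm_add_le (y - c) c; simpa using this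
  have hrn : 0 ≤ r := norm_nonneg _
  set e := exp (-r^2/(8*t)) with he
  have he0 : 0 < e := by positivity
  have he1 : e ≤ 1 := by
    rw [he, Real.exp_le_one_iff]; apply div_nonpos_of_nonpos_of_nonneg <;> nlinarith
  have h8 : √(8*t) ≤ w := Real.sqrt_le_sqrt (by nlinarith [Real.pi_gt_three])
  have her : e * r ≤ w := by
    set v := √(8*t) with hv
    have hvp : 0 < v := by positivity
    have hv2 : v^2 = 8*t := Real.sq_sqrt (by positivity)
    have : e * (r/v) ≤ 1 := by
      rw [he, ← hv2, neg_div, ← div_pow, Real.exp_neg]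
      rw [inv_mul_le_iff₀ (by positivity)]
      have := Real.add_one_le_exp ((r/v)^2)
      nlinarith [sq_nonneg (r/v - 1)]
    have h2 : e * r = e * (r/v) * v := by field_simp
    rw [h2]
    nlinarith
  calc e / w^3 * (1 + ‖y‖) ≤ e / w^3 * (1 + ‖c‖ + r) :=
        mul_le_mul_of_nonneg_left (by linarith) (by positivity)
    _ = (e * (1+‖c‖) + e * r)/w^3 := by ring
    _ ≤ (1 * (1+‖c‖) + w)/w^3 := by gcongr
    _ = (1+‖c‖)/w^3 + 1/w^2 := by field_simp
    _ ≤ _ := by gcongr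

lemma schlo (a : ℝ) (ha : 0 < a) :
    ∫⁻ t in Set.Ioi (0:ℝ), ENNReal.ofReal (a/(t*√t) * exp (-(√t - a/√t)^2))
      = ENNReal.ofReal (√π) := by
  set F : ℝ → ℝ := fun t => exp (-(√t - a/√t)^2) with hF
  have hFm : Measurable F := by fun_prop
  have hA : ∫⁻ t in Set.Ioi (0:ℝ), ENNReal.ofReal (1/(2*√t) + a/(2*(t*√t))) * ENNReal.ofReal (F t)
      = ENNReal.ofReal (√π) := by
    have himg : (fun t => √t - a/√t) '' Set.Ioi 0 = Set.univ := by
      apply Set.eq_univ_of_forall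
      intro v
      set q := (v + √(v^2+4*a))/2 with hq
      have h1 : √(v^2+4*a)^2 = v^2+4*a := Real.sq_sqrt (by positivity)
      have h2 : |v| < √(v^2+4*a) := by
        rw [← Real.sqrt_sq_eq_abs]; exact Real.sqrt_lt_sqrt (by positivity) (by linarith)
      have hqp : 0 < q := by have := neg_abs_le v; rw [hq]; linarith
      refine ⟨q^2, by simpa using by positivity, ?_⟩
      simp only [Real.sqrt_sq hqp.le]
      field_simp
      rw [hq]; nlinarith
    have := lintegral_image_eq_lintegral_abs_deriv_mul (s := Set.Ioi (0:ℝ))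
      (f := fun t => √t - a/√t) (f' := fun t => 1/(2*√t) + a/(2*(t*√t))) measurableSet_Ioi ?_ ?_
      (fun v => ENNReal.ofReal (exp (-v^2)))
    · rw [himg, Measure.restrict_univ, ← ofReal_integral_eq_lintegral_ofReal] at this
      · have h3 := integral_gaussian 1
        simp only [neg_mul, one_mul, div_one] at h3
        rw [h3] at this
        rw [this]
        apply setLIntegral_congr_fun measurableSet_Ioi
        intro t ht
        have ht : 0 < t := ht
        simp only [hF]
        rw [abs_of_nonneg (by positivity)]
      · simpa using integrable_exp_neg_mul_sq (one_pos)
      · exact ae_of_all _ fun x => by positivity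
    · intro t ht
      have ht : 0 < t := ht
      have hd := Real.hasDerivAt_sqrt ht.ne'
      have hd2 := hd.sub ((hasDerivAt_const t a).div hd (by positivity))
      refine (hd2.congr_deriv ?_).hasDerivWithinAt
      have : √t^2 = t := Real.sq_sqrt ht.le
      rw [this]; field_simp; ring
    · apply StrictMonoOn.injOn
      intro t ht u hu htu
      have ht : 0 < t := ht
      have h1 : √t < √u := Real.sqrt_lt_sqrt ht.le htu
      have h0 : 0 < √t := by positivity
      have : a/√u < a/√t := by gcongr
      simp only; linarith
  have hB : ∫⁻ t in Set.Ioi (0:ℝ), ENNReal.ofReal (1/(2*√t)) * ENNReal.ofReal (F t)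
      = ∫⁻ t in Set.Ioi (0:ℝ), ENNReal.ofReal (a/(2*(t*√t))) * ENNReal.ofReal (F t) := by
    have himg : (fun t => a^2/t) '' Set.Ioi 0 = Set.Ioi (0:ℝ) := by
      ext v
      constructor
      · rintro ⟨t, ht, rfl⟩
        have ht : 0 < t := ht
        exact Set.mem_Ioi.2 (by positivity)
      · intro hv
        have hv : 0 < v := hv
        exact ⟨a^2/v, Set.mem_Ioi.2 (by positivity), by simp only; field_simp⟩
    have := lintegral_image_eq_lintegral_abs_deriv_mul (s := Set.Ioi (0:ℝ))
      (f := fun t => a^2/t) (f' := fun t => -(a^2/t^2)) measurableSet_Ioi ?_ ?_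
      (fun t => ENNReal.ofReal (1/(2*√t)) * ENNReal.ofReal (F t))
    · rw [himg] at this
      rw [this]
      apply setLIntegral_congr_fun measurableSet_Ioi
      intro t ht
      have ht : 0 < t := ht
      have hs : √(a^2/t) = a/√t := by rw [Real.sqrt_div (by positivity), Real.sqrt_sq ha.le]
      simp only [hF, hs]
      rw [abs_neg, abs_of_nonneg (by positivity), ← mul_assoc, ← ENNReal.ofReal_mul (by positivity)]
      have h2 : √t^2 = t := Real.sq_sqrt ht.le
      have h3 : a / (a/√t) = √t := by field_simp
      congr 2
      · field_simp; rw [h2]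
      · rw [h3]; congr 1; ring
    · intro t ht
      have ht : 0 < t := ht
      have := (hasDerivAt_const t (a^2)).div (hasDerivAt_id t) ht.ne'
      refine (this.congr_deriv ?_).hasDerivWithinAt
      simp; ring
    · intro t ht u hu h
      have ht : 0 < t := ht
      have hu : 0 < u := hu
      simp only at h
      field_simp at h
      exact h.symm
  have e1 : ∀ t ∈ Set.Ioi (0:ℝ), ENNReal.ofReal (1/(2*√t) + a/(2*(t*√t))) * ENNReal.ofReal (F t)
     = ENNReal.ofReal (1/(2*√t)) * ENNReal.ofReal (F t) + ENNReal.ofReal (a/(2*(t*√t))) * ENNReal.ofReal (F t) := by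
    intro t ht
    have ht : 0 < t := ht
    rw [ENNReal.ofReal_add (by positivity) (by positivity), add_mul]
  rw [setLIntegral_congr_fun measurableSet_Ioi e1, lintegral_add_left (by fun_prop), hB,
    ← lintegral_add_left (by fun_prop)] at hA
  rw [← hA]
  apply setLIntegral_congr_fun measurableSet_Ioi
  intro t ht
  have ht : 0 < t := ht
  simp only
  rw [← add_mul, ← ENNReal.ofReal_add (by positivity) (by positivity), ← ENNReal.ofReal_mul (by positivity)]
  congr 2
  ring

lemma GK_eq (z : E3) (hz : z ≠ 0) :
    ∫⁻ t in Set.Ioi (0:ℝ), ENNReal.ofReal (exp (-t) * HK t z) = ENNReal.ofReal (GK z) := by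
  have hr : 0 < ‖z‖ := norm_pos_iff.2 hz
  set r := ‖z‖ with hrr
  set a := r / √8 with ha
  have hap : 0 < a := by positivity
  have h8 : √8 = 2 * √2 := by
    rw [show (8:ℝ) = 2^2*2 by norm_num, Real.sqrt_mul (by positivity), Real.sqrt_sq (by norm_num)]
  have h22 : √2^2 = 2 := Real.sq_sqrt (by norm_num)
  have hconst : GK z = exp (-r/√2)/ (a * (√(8*π))^3) * √π := by
    unfold GK
    rw [← hrr, ha, Real.sqrt_mul (by positivity), h8]
    have : √π^2 = π := Real.sq_sqrt (by positivity)
    field_simp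
    rw [this, h22]; ring
  rw [hconst, ENNReal.ofReal_mul (by positivity), ← schlo a hap, ← lintegral_const_mul' _ _ (by simp)]
  apply setLIntegral_congr_fun measurableSet_Ioi
  intro t ht
  have ht : 0 < t := ht
  simp only
  rw [← ENNReal.ofReal_mul (by positivity)]
  congr 1
  unfold HK
  rw [← hrr]
  have e1 : -t + -r^2/(8*t) = -r/√2 + -(√t - a/√t)^2 := by
    have : √t^2 = t := Real.sq_sqrt ht.le
    have h4 : a^2 = r^2/8 := by rw [ha, div_pow, Real.sq_sqrt (by norm_num)]
    have h5 : 2 * a = r/√2 := by rw [ha, h8]; field_simp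
    have : (√t - a/√t)^2 = t - 2*a + a^2/t := by
      rw [sub_sq, div_pow, this]; field_simp
    rw [this, h4, h5]; field_simp; ring
  have e2 : √(8*π*t)^3 = √(8*π)^3 * (t*√t) := by
    rw [Real.sqrt_mul (by positivity), mul_pow]
    have : √t^2 = t := Real.sq_sqrt ht.le
    rw [show √t^3 = √t^2*√t by ring, this]
  rw [mul_div_assoc', ← Real.exp_add, e1, Real.exp_add, e2]
  field_simp

lemma QL {s : ℝ} (hs : 0 < s) (c y : E3) :
    ∫⁻ x, ENNReal.ofReal (HK s (x - c) * GK (x - y)) =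
      ∫⁻ t in Set.Ioi (0:ℝ), ENNReal.ofReal (exp (-t) * HK (s+t) (y-c)) := by
  have h1 : ∀ᵐ x : E3, ENNReal.ofReal (HK s (x - c) * GK (x - y)) =
      ∫⁻ t in Set.Ioi (0:ℝ), ENNReal.ofReal (HK s (x - c)) * ENNReal.ofReal (exp (-t) * HK t (x-y)) := by
    have : ∀ᵐ x : E3, x ≠ y := by
      rw [ae_iff]; simp
    filter_upwards [this] with x hx
    rw [lintegral_const_mul' _ _ (by simp), GK_eq _ (sub_ne_zero.2 hx),
      ENNReal.ofReal_mul (HK_nonneg _ _)]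
  rw [lintegral_congr_ae h1, lintegral_lintegral_swap]
  · apply setLIntegral_congr_fun measurableSet_Ioi
    intro t ht
    have ht : 0 < t := ht
    simp only
    rw [ENNReal.ofReal_mul (by positivity), ← HK_semigroup_l hs ht, ← lintegral_const_mul' _ _ (by simp)]
    apply lintegral_congr
    intro x
    rw [ENNReal.ofReal_mul (by positivity), ENNReal.ofReal_mul (HK_nonneg _ _)]
    ring
  · apply Measurable.aemeasurable
    unfold HK
    fun_prop

lemma GK_nonneg (z) : 0 ≤ GK z := by unfold GK; positivity

lemma expInt : Integrable (fun t : ℝ => exp (-t)) (volume.restrict (Set.Ioi 0)) := by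
  exact integrableOn_exp_neg_Ioi 0

lemma HKs_int {s : ℝ} (hs : 0 < s) (c y : E3) :
    Integrable (fun t : ℝ => exp (-t) * HK (s+t) (y-c)) (volume.restrict (Set.Ioi 0)) := by
  obtain ⟨C, hC, hb⟩ := HK_bound hs c
  refine (expInt.mul_const (C * (1 + ‖y‖)⁻¹)).mono' ?_ ?_
  · apply Measurable.aestronglyMeasurable
    unfold HK; fun_prop
  · filter_upwards [ae_restrict_mem measurableSet_Ioi] with t ht
    have ht : 0 < t := ht
    rw [Real.norm_of_nonneg (mul_nonneg (by positivity) (HK_nonneg _ _))]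
    gcongr
    exact hb _ (by linarith) y

lemma Q_int {s : ℝ} (hs : 0 < s) (c y : E3) :
    Integrable (fun x => HK s (x - c) * GK (x - y)) := by
  refine ⟨?_, ?_⟩
  · apply Measurable.aestronglyMeasurable
    unfold HK GK; fun_prop
  · rw [hasFiniteIntegral_iff_ofReal (ae_of_all _ fun x => mul_nonneg (HK_nonneg _ _) (GK_nonneg _)),
      QL hs]
    exact (hasFiniteIntegral_iff_ofReal (ae_of_all _ fun x => mul_nonneg (by positivity) (HK_nonneg _ _))).1
      (HKs_int hs c y).2

lemma Q_eq {s : ℝ} (hs : 0 < s) (c y : E3) :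
    ∫ x, HK s (x - c) * GK (x - y) = ∫ t in Set.Ioi (0:ℝ), exp (-t) * HK (s+t) (y-c) := by
  rw [integral_eq_lintegral_of_nonneg_ae, integral_eq_lintegral_of_nonneg_ae, QL hs]
  · exact ae_of_all _ fun x => mul_nonneg (by positivity) (HK_nonneg _ _)
  · exact (HKs_int hs c y).1
  · exact ae_of_all _ fun x => mul_nonneg (HK_nonneg _ _) (GK_nonneg _)
  · exact (Q_int hs c y).1

lemma Q_bound {s : ℝ} (hs : 0 < s) (c : E3) : ∃ C : ℝ, 0 ≤ C ∧ ∀ y : E3,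
    ∫ x, HK s (x - c) * GK (x - y) ≤ C * (1 + ‖y‖)⁻¹ := by
  obtain ⟨C, hC, hb⟩ := HK_bound hs c
  refine ⟨C, hC, fun y => ?_⟩
  rw [Q_eq hs]
  calc _ ≤ ∫ t in Set.Ioi (0:ℝ), exp (-t) * (C * (1 + ‖y‖)⁻¹) := by
        apply integral_mono_ae (HKs_int hs c y) (expInt.mul_const _)
        filter_upwards [ae_restrict_mem measurableSet_Ioi] with t ht
        have ht : 0 < t := ht
        gcongr
        exact hb _ (by linarith) y
    _ = _ := by rw [integral_mul_const, integral_exp_neg_Ioi_zero, one_mul]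

lemma aesm_smul {k : E3 → ℝ} {f : E3 → ℂ} (hk : AEStronglyMeasurable k) (hf : AEStronglyMeasurable f) :
    AEStronglyMeasurable (fun y => k y • f y) := hk.smul hf

lemma contOn_smul {k : ℝ → ℝ} {f : ℝ → ℂ} {S : Set ℝ} (hk : ContinuousOn k S) (hf : ContinuousOn f S) :
    ContinuousOn (fun y => k y • f y) S := hk.smul hf

section core
variable {f : E3 → ℂ}

lemma step2 (hf : AEStronglyMeasurable f)
    (hfi : Integrable (fun y => (1 + ‖y‖)⁻¹ * ‖f y‖))
    (h0 : ∀ᵐ x : E3, ∫ y, GK (x - y) • f y = 0) {s : ℝ} (hs : 0 < s) (c : E3) :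
    ∫ t in Set.Ioi (0:ℝ), exp (-t) • ∫ y, HK (s+t) (y-c) • f y = 0 := by
  have hfm : AEStronglyMeasurable (fun p : E3 × E3 => f p.2) (volume.prod volume) := hf.comp_snd
  have I1 : Integrable (Function.uncurry fun x y => (HK s (x - c) * GK (x - y)) • f y)
      ((volume : Measure E3).prod volume) := by
    have hm : AEStronglyMeasurable (Function.uncurry fun x y => (HK s (x - c) * GK (x - y)) • f y)
      ((volume : Measure E3).prod volume) := by
      refine AEStronglyMeasurable.smul (f := fun p : E3 × E3 => HK s (p.1 - c) * GK (p.1 - p.2)) ?_ hfm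
      apply Measurable.aestronglyMeasurable
      unfold HK GK; fun_prop
    rw [integrable_prod_iff' hm]
    refine ⟨ae_of_all _ fun y => (Q_int hs c y).smul_const (f y), ?_⟩
    obtain ⟨C, hC, hb⟩ := Q_bound hs c
    refine (hfi.const_mul C).mono' hm.norm.prod_swap.integral_prod_right' ?_
    refine ae_of_all _ fun y => ?_
    have : ∫ x, ‖Function.uncurry (fun x y => (HK s (x - c) * GK (x - y)) • f y) (x, y)‖ =
        (∫ x, HK s (x - c) * GK (x - y)) * ‖f y‖ := by
      rw [← integral_mul_const]
      congr 1; ext x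
      simp only [Function.uncurry, norm_smul]
      rw [Real.norm_of_nonneg (mul_nonneg (HK_nonneg _ _) (GK_nonneg _))]
    rw [this, Real.norm_of_nonneg (mul_nonneg (integral_nonneg fun x => mul_nonneg (HK_nonneg _ _) (GK_nonneg _)) (norm_nonneg _)),
      ← mul_assoc]
    exact mul_le_mul_of_nonneg_right (hb y) (norm_nonneg _)
  have I2 : Integrable (Function.uncurry fun t y => (exp (-t) * HK (s+t) (y-c)) • f y)
      ((volume.restrict (Set.Ioi (0:ℝ))).prod (volume : Measure E3)) := by
    obtain ⟨C, hC, hb⟩ := HK_bound hs c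
    have hm : AEStronglyMeasurable (Function.uncurry fun t y => (exp (-t) * HK (s+t) (y-c)) • f y)
      ((volume.restrict (Set.Ioi (0:ℝ))).prod (volume : Measure E3)) := by
      refine AEStronglyMeasurable.smul (f := fun p : ℝ × E3 => exp (-p.1) * HK (s+p.1) (p.2 - c)) ?_ hf.comp_snd
      apply Measurable.aestronglyMeasurable
      unfold HK; fun_prop
    refine (expInt.mul_prod (hfi.const_mul C)).mono' hm ?_
    have : ∀ᵐ p ∂((volume.restrict (Set.Ioi (0:ℝ))).prod (volume : Measure E3)), 0 < p.1 :=
      Measure.quasiMeasurePreserving_fst.ae (ae_restrict_mem measurableSet_Ioi)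
    filter_upwards [this] with p hp
    simp only [Function.uncurry, norm_smul]
    rw [Real.norm_of_nonneg (mul_nonneg (by positivity) (HK_nonneg _ _)), mul_assoc]
    refine mul_le_mul_of_nonneg_left ?_ (by positivity)
    rw [← mul_assoc]
    exact mul_le_mul_of_nonneg_right (hb _ (by linarith) _) (norm_nonneg _)
  have e1 : ∫ x, ∫ y, (HK s (x - c) * GK (x - y)) • f y = 0 := by
    apply integral_eq_zero_of_ae
    filter_upwards [h0] with x hx
    simp only [mul_smul, integral_smul, hx, smul_zero, Pi.zero_apply]
  rw [integral_integral_swap I1] at e1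
  simp only [integral_smul_const, Q_eq hs] at e1
  rw [← e1]
  simp only [← integral_smul_const]
  rw [← integral_integral_swap I2]
  simp only [mul_smul, integral_smul]

lemma step3 (hf : AEStronglyMeasurable f)
    (hfi : Integrable (fun y => (1 + ‖y‖)⁻¹ * ‖f y‖))
    (h0 : ∀ᵐ x : E3, ∫ y, GK (x - y) • f y = 0) {s : ℝ} (hs : 0 < s) (c : E3) :
    ∫ y, HK s (y-c) • f y = 0 := by
  set u : ℝ → ℂ := fun t => ∫ y, HK t (y-c) • f y with hu
  set a := s/2 with ha
  have hap : 0 < a := by positivity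
  obtain ⟨C, hC, hb⟩ := HK_bound hap c
  have hbd : ∀ t, a ≤ t → ∀ y, ‖HK t (y-c) • f y‖ ≤ C * ((1 + ‖y‖)⁻¹ * ‖f y‖) := by
    intro t ht y
    rw [norm_smul, Real.norm_of_nonneg (HK_nonneg _ _), ← mul_assoc]
    gcongr
    exact hb t ht y
  have hcont : ContinuousOn u (Set.Ici a) := by
    refine continuousOn_of_dominated (bound := fun y => C * ((1 + ‖y‖)⁻¹ * ‖f y‖)) ?_ ?_ (hfi.const_mul C) ?_
    · intro t ht
      refine aesm_smul ?_ hf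
      apply Measurable.aestronglyMeasurable
      unfold HK; fun_prop
    · exact fun t ht => ae_of_all _ (hbd t ht)
    · refine ae_of_all _ fun y => ?_
      refine contOn_smul ?_ continuousOn_const
      intro t ht
      have ht : 0 < t := hap.trans_le ht
      apply ContinuousAt.continuousWithinAt
      unfold HK
      have h1 : 8 * t ≠ 0 := by positivity
      have h2 : √(8*π*t)^3 ≠ 0 := by positivity
      fun_prop (disch := assumption)
  have hubd : ∀ t, a ≤ t → ‖u t‖ ≤ ∫ y, C * ((1 + ‖y‖)⁻¹ * ‖f y‖) := fun t ht =>
    norm_integral_le_of_norm_le (hfi.const_mul C) (ae_of_all _ (hbd t ht))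
  set v : ℝ → ℂ := fun t => exp (-t) • u t with hv
  have hvc : ContinuousOn v (Set.Ici a) := by
    refine contOn_smul ?_ hcont
    fun_prop
  have hvi : IntegrableOn v (Set.Ioi a) := by
    refine ((integrableOn_exp_neg_Ioi a).mul_const (∫ y, C * ((1 + ‖y‖)⁻¹ * ‖f y‖))).mono' ?_ ?_
    · exact (hvc.mono Set.Ioi_subset_Ici_self).aestronglyMeasurable measurableSet_Ioi
    · filter_upwards [ae_restrict_mem measurableSet_Ioi] with t ht
      simp only [hv, norm_smul]
      rw [Real.norm_of_nonneg (by positivity)]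
      gcongr
      exact hubd t (le_of_lt ht)
  have hz : ∀ b, a ≤ b → ∫ t in Set.Ioi b, v t = 0 := by
    intro b hab
    have hbp : 0 < b := hap.trans_le hab
    have h2 := step2 hf hfi h0 hbp c
    have h3 : ∫ t in Set.Ioi b, v t = ∫ t in Set.Ioi 0, v (b + t) := by
      have := (measurePreserving_add_left (volume : Measure ℝ) b).setIntegral_preimage_emb
        (measurableEmbedding_addLeft b) v (Set.Ioi b)
      rw [Set.preimage_const_add_Ioi, sub_self] at this
      exact this.symm
    rw [h3]
    have h4 : ∀ t, v (b+t) = exp (-b) • (exp (-t) • ∫ y, HK (b+t) (y-c) • f y) := by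
      intro t
      simp only [hv, hu]
      rw [smul_smul, ← Real.exp_add]
      congr 2; ring
    simp only [h4]
    rw [integral_smul, h2, smul_zero]
  have hint : ∀ b, a ≤ b → ∫ t in a..b, v t = 0 := by
    intro b hab
    have := intervalIntegral.integral_Ioi_sub_Ioi hvi hab
    rw [hz a le_rfl, hz b hab, sub_zero] at this
    exact this.symm
  have has : a < s := by rw [ha]; linarith
  have hd : HasDerivAt (fun b => ∫ t in a..b, v t) (v s) s := by
    apply intervalIntegral.integral_hasDerivAt_right
    · apply ContinuousOn.intervalIntegrable
      apply hvc.mono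
      rw [Set.uIcc_of_le has.le]
      exact Set.Icc_subset_Ici_self
    · exact (hvc.mono Set.Ioi_subset_Ici_self).stronglyMeasurableAtFilter isOpen_Ioi _ has
    · exact hvc.continuousAt (Ici_mem_nhds has)
  have hd0 : HasDerivAt (fun b => ∫ t in a..b, v t) 0 s := by
    refine (hasDerivAt_const s (0:ℂ)).congr_of_eventuallyEq ?_
    filter_upwards [Ici_mem_nhds has] with b hb
    exact hint b hb
  have := hd.unique hd0
  simp only [hv] at this
  exact (smul_eq_zero.1 this).resolve_left (by positivity)

lemma step4 (h : ∀ s : ℝ, 0 < s → ∀ c, ∫ y, HK s (y-c) • f y = 0) {b : ℝ} (hb : 0 < b) (c : E3) :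
    ∫ y, exp (-b * ‖y - c‖^2) • (exp (-‖y‖^2) • f y) = 0 := by
  set t := 1/(8*(b+1)) with ht
  have htp : 0 < t := by positivity
  have h1 := h t htp ((b/(b+1)) • c)
  have e : ∀ y, exp (-b * ‖y - c‖^2) • (exp (-‖y‖^2) • f y) =
      (exp (-(b/(b+1)) * ‖c‖^2) * √(8*π*t)^3) • (HK t (y - (b/(b+1)) • c) • f y) := by
    intro y
    rw [smul_smul, smul_smul]
    congr 1
    unfold HK
    have hne : √(8*π*t)^3 ≠ 0 := by positivity
    rw [← Real.exp_add, mul_assoc, mul_div_cancel₀ _ hne, ← Real.exp_add]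
    congr 1
    rw [ht]
    simp only [EuclideanSpace.norm_sq_eq, Fin.sum_univ_three, Real.norm_eq_abs, sq_abs,
      PiLp.sub_apply, PiLp.smul_apply, smul_eq_mul]
    field_simp
    ring
  simp only [e]
  rw [integral_smul, h1, smul_zero]

lemma step5 {F : E3 → ℂ} (hF : Integrable F)
    (h : ∀ b : ℝ, 0 < b → ∀ c, ∫ y, exp (-b * ‖y - c‖^2) • F y = 0) : ∀ᵐ y, F y = 0 := by
  apply ae_eq_zero_of_integral_contDiff_smul_eq_zero hF.locallyIntegrable
  intro φ hφ hφc
  have hφi : Integrable φ := hφ.continuous.integrable_of_hasCompactSupport hφc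
  obtain ⟨M, hM⟩ := hφc.exists_bound_of_continuous hφ.continuous
  set p : E3 → ℝ := fun x => exp (-π * ‖x‖^2) with hp
  have hp1 : ∫ x, p x = 1 := by
    have := gauss3 π Real.pi_pos 0
    simp only [sub_zero] at this
    rw [hp, this, div_self Real.pi_ne_zero]; simp
  have hpd : Tendsto (fun x : E3 => ‖x‖ ^ Module.finrank ℝ E3 * p x) (Bornology.cobounded E3) (𝓝 0) := by
    have h1 : Tendsto (fun r : ℝ => r^3 * exp (-π * r^2)) atTop (𝓝 0) := by
      have h2 := Real.tendsto_pow_mul_exp_neg_atTop_nhds_zero 3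
      refine squeeze_zero' ?_ ?_ h2
      · filter_upwards [eventually_ge_atTop 0] with r hr
        positivity
      · filter_upwards [eventually_ge_atTop 1] with r hr
        gcongr
        nlinarith [Real.pi_gt_three]
    have h3 := h1.comp (tendsto_norm_cobounded_atTop (E := E3))
    simpa [hp, Function.comp_def] using h3
  have key : Tendsto (fun k : ℝ => ∫ y, (∫ x, (k ^ (Module.finrank ℝ E3) * p (k • (y - x))) • φ x) • F y)
      atTop (𝓝 (∫ y, φ y • F y)) := by
    refine tendsto_integral_filter_of_dominated_convergence (fun y => M * ‖F y‖) ?_ ?_ (hF.norm.const_mul M) ?_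
    · refine Eventually.of_forall fun k => ?_
      refine aesm_smul ?_ hF.1
      apply StronglyMeasurable.aestronglyMeasurable
      apply StronglyMeasurable.integral_prod_right (f := fun y x => (k ^ (Module.finrank ℝ E3) * p (k • (y - x))) • φ x)
      apply Continuous.stronglyMeasurable
      have := hφ.continuous
      simp only [hp, Function.uncurry_def]
      fun_prop
    · filter_upwards [eventually_gt_atTop 0] with k hk
      refine ae_of_all _ fun y => ?_
      rw [norm_smul]
      gcongr
      have hgi := (gauss3_int (π * k^2) (by positivity) y).const_mul (k^3 * M)
      refine (norm_integral_le_of_norm_le hgi (ae_of_all _ fun x => ?_)).trans ?_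
      · rw [norm_smul, Real.norm_of_nonneg (by positivity)]
        simp only [hp, finrank_euclideanSpace, Fintype.card_fin, norm_smul, mul_pow, Real.norm_eq_abs, sq_abs]
        rw [norm_sub_rev y x]
        calc _ ≤ k ^ 3 * rexp (-π * (k ^ 2 * ‖x - y‖ ^ 2)) * M := by
              gcongr; exact hM x
          _ = _ := by rw [show -(π * k^2) * ‖x-y‖^2 = -π * (k ^ 2 * ‖x - y‖ ^ 2) by ring]; ring
      · rw [integral_const_mul, gauss3 _ (by positivity)]
        apply le_of_eq
        have : √(π/(π * k^2)) = 1/k := by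
          rw [show π/(π*k^2) = (1/k)^2 by field_simp]
          exact Real.sqrt_sq (by positivity)
        rw [this]; field_simp
    · refine ae_of_all _ fun y => ?_
      refine Tendsto.smul_const ?_ _
      exact tendsto_integral_comp_smul_smul_of_integrable' (fun x => by positivity) hp1 hpd hφi hφ.continuous.continuousAt
  refine tendsto_nhds_unique key ?_
  refine tendsto_const_nhds.congr' ?_
  filter_upwards [eventually_gt_atTop 0] with k hk
  have I : Integrable (Function.uncurry fun x y => ((k ^ (Module.finrank ℝ E3) * p (k • (y - x))) • φ x) • F y)
      ((volume : Measure E3).prod volume) := by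
    refine ((hφi.norm.const_mul (k^3)).mul_prod hF.norm).mono' ?_ ?_
    · refine AEStronglyMeasurable.smul (f := fun q : E3 × E3 => (k ^ (Module.finrank ℝ E3) * p (k • (q.2 - q.1))) • φ q.1) ?_ hF.1.comp_snd
      apply Continuous.aestronglyMeasurable
      have := hφ.continuous
      simp only [hp]
      fun_prop
    · refine ae_of_all _ fun q => ?_
      simp only [Function.uncurry, norm_smul]
      rw [Real.norm_of_nonneg (by positivity)]
      simp only [finrank_euclideanSpace, Fintype.card_fin]
      gcongr
      have : p (k • (q.2 - q.1)) ≤ 1 := by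
        simp only [hp]
        rw [Real.exp_le_one_iff]
        have : 0 ≤ π * ‖k • (q.2 - q.1)‖^2 := by positivity
        linarith
      have h3 : 0 < k^3 := by positivity
      nlinarith
  simp only [← integral_smul_const]
  rw [← integral_integral_swap I]
  symm
  apply integral_eq_zero_of_ae
  refine ae_of_all _ fun x => ?_
  simp only [Pi.zero_apply]
  have h1 := h (π * k^2) (by positivity) x
  have e : ∀ y, ((k ^ (Module.finrank ℝ E3) * p (k • (y - x))) • φ x) • F y =
     (k^3 * φ x) • (exp (-(π * k^2) * ‖y - x‖^2) • F y) := by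
    intro y
    simp only [hp, finrank_euclideanSpace, Fintype.card_fin, norm_smul, mul_pow, Real.norm_eq_abs, sq_abs]
    rw [smul_smul, smul_eq_mul]
    congr 1
    rw [show -(π * k^2) * ‖y-x‖^2 = -π * (k ^ 2 * ‖y - x‖ ^ 2) by ring]; ring
  simp only [e]
  rw [integral_smul, h1, smul_zero]

lemma core (hf : AEStronglyMeasurable f)
    (hfi : Integrable (fun y => (1 + ‖y‖)⁻¹ * ‖f y‖))
    (h0 : ∀ᵐ x : E3, ∫ y, GK (x - y) • f y = 0) : ∀ᵐ y, f y = 0 := by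
  have h3 : ∀ s : ℝ, 0 < s → ∀ c, ∫ y, HK s (y-c) • f y = 0 := fun s hs c => step3 hf hfi h0 hs c
  have hF : Integrable (fun y => exp (-‖y‖^2) • f y) := by
    refine (hfi.const_mul 2).mono' ?_ (ae_of_all _ fun y => ?_)
    · refine aesm_smul ?_ hf
      apply Continuous.aestronglyMeasurable
      fun_prop
    · rw [norm_smul, Real.norm_of_nonneg (by positivity)]
      rw [← mul_assoc]
      refine mul_le_mul_of_nonneg_right ?_ (norm_nonneg _)
      rw [Real.exp_neg, ← div_eq_mul_inv, le_div_iff₀ (by positivity), inv_mul_le_iff₀ (by positivity)]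
      have := Real.add_one_le_exp (‖y‖^2)
      nlinarith [sq_nonneg (‖y‖-1)]
  filter_upwards [step5 hF (fun b hb c => step4 h3 hb c)] with y hy
  exact (smul_eq_zero.1 hy).resolve_left (by positivity)
end core

/-- For a Rollnik potential `V` with `V > 0` a.e., the Birman–Schwinger operator
`B = √V (2(-Δ)+1)⁻¹ √V`, with integral kernel
`√V(x) e^{-|x-y|/√2} √V(y)/(8π|x-y|)`, has no zero eigenvalue: if `g ∈ L²` and
`(Bg)(x) = 0` for a.e. `x`, then `g = 0` a.e. -/
theorem BS_no_zero_eigenvalue (V : EuclideanSpace ℝ (Fin 3) → ℝ) (hV : Measurable V)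
    (hVpos : ∀ᵐ x ∂(volume : Measure (EuclideanSpace ℝ (Fin 3))), 0 < V x)
    (hR : rollnik V < ⊤)
    (g : EuclideanSpace ℝ (Fin 3) → ℂ) (hg : MemLp g 2)
    (hBg : ∀ᵐ x ∂(volume : Measure (EuclideanSpace ℝ (Fin 3))),
      (∫ y, (Real.sqrt (V x) * Real.exp (-‖x - y‖ / Real.sqrt 2)
          * Real.sqrt (V y) / (8 * π * ‖x - y‖)) • g y) = 0) :
    g =ᵐ[volume] 0 := by
  have hf : AEStronglyMeasurable (fun y => √(V y) • g y) :=
    aesm_smul hV.sqrt.aestronglyMeasurable hg.1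
  -- a point where the inner Rollnik integral is finite
  have hfin : ∀ᵐ x : E3, ∫⁻ y, ENNReal.ofReal (|V x| * |V y| / ‖x - y‖ ^ 2) < ⊤ := by
    refine ae_lt_top ?_ hR.ne
    apply Measurable.lintegral_prod_right (f := fun x y : E3 => ENNReal.ofReal (|V x| * |V y| / ‖x - y‖ ^ 2))
    have h1 : Measurable (fun p : E3 × E3 => V p.1) := hV.comp measurable_fst
    have h2 : Measurable (fun p : E3 × E3 => V p.2) := hV.comp measurable_snd
    simp only [Function.uncurry_def, ← Real.norm_eq_abs]
    fun_prop
  obtain ⟨x0, hx0, hx0pos⟩ := (hfin.and hVpos).exists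
  have hg2 : Integrable (fun y => ‖g y‖^2) := (memLp_two_iff_integrable_sq_norm hg.1).1 hg
  have hVi : Integrable (fun y => |V x0| * |V y| / ‖x0 - y‖^2) := by
    refine ⟨?_, ?_⟩
    · apply Measurable.aestronglyMeasurable
      simp only [← Real.norm_eq_abs]
      fun_prop
    · rw [hasFiniteIntegral_iff_ofReal (ae_of_all _ fun y => by positivity)]
      exact hx0
  have hfi : Integrable (fun y => (1 + ‖y‖)⁻¹ * ‖√(V y) • g y‖) := by
    refine (((hVi.const_mul (|V x0|)⁻¹).add hg2).const_mul (1+‖x0‖)).mono' ?_ ?_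
    · refine AEStronglyMeasurable.mul ?_ hf.norm
      apply Measurable.aestronglyMeasurable
      fun_prop
    · have hne : ∀ᵐ y : E3, y ≠ x0 := by
        rw [ae_iff]; simp
      filter_upwards [hne, hVpos] with y hy hVy
      have hr : 0 < ‖x0 - y‖ := norm_pos_iff.2 (sub_ne_zero.2 (Ne.symm hy))
      have htri : ‖x0 - y‖ ≤ (1+‖x0‖)*(1+‖y‖) := by
        have := norm_sub_le x0 y
        nlinarith [norm_nonneg x0, norm_nonneg y]
      rw [Real.norm_of_nonneg (by positivity), norm_smul, Real.norm_of_nonneg (by positivity)]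
      have h1 : (1+‖y‖)⁻¹ ≤ (1+‖x0‖) / ‖x0-y‖ := by
        rw [le_div_iff₀ hr, inv_mul_le_iff₀ (by positivity)]
        linarith
      have h2 : |V x0|⁻¹ * (|V x0| * |V y| / ‖x0 - y‖^2) = (√(V y)/‖x0-y‖)^2 := by
        rw [div_pow, Real.sq_sqrt hVy.le, abs_of_pos hVy]
        have : |V x0| ≠ 0 := by positivity
        field_simp
      simp only [Pi.add_apply]
      rw [h2]
      calc _ ≤ (1+‖x0‖) / ‖x0-y‖ * (√(V y) * ‖g y‖) := by gcongr
        _ = (1+‖x0‖) * ((√(V y)/‖x0-y‖) * ‖g y‖) := by ring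
        _ ≤ _ := by
          refine mul_le_mul_of_nonneg_left ?_ (by positivity)
          nlinarith [sq_nonneg (√(V y)/‖x0-y‖ - ‖g y‖), sq_nonneg (√(V y)/‖x0-y‖ + ‖g y‖)]
  have h0 : ∀ᵐ x : E3, ∫ y, GK (x - y) • (√(V y) • g y) = 0 := by
    filter_upwards [hBg, hVpos] with x hx hVx
    have e : ∀ y, (Real.sqrt (V x) * Real.exp (-‖x - y‖ / Real.sqrt 2)
          * Real.sqrt (V y) / (8 * π * ‖x - y‖)) • g y = √(V x) • (GK (x-y) • (√(V y) • g y)) := by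
      intro y
      rw [smul_smul, smul_smul]
      congr 1
      unfold GK
      ring
    simp only [e] at hx
    rw [integral_smul] at hx
    exact (smul_eq_zero.1 hx).resolve_left (by positivity)
  filter_upwards [core hf hfi h0, hVpos] with y hy hVy
  exact (smul_eq_zero.1 hy).resolve_left (by positivity)
end
end
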